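/- Neither of the functions Sum, Prod : ℙ → ℙ is (𝒰 ∪ 𝒫)-definable, where Sum(x) = {Σ_{n∈x} n} if x is finite and ℕ otherwise, and Prod(x) = {∏_{n∈x} n} if x is finite and ℕ otherwise. -/

import Mathlib

noncomputable section
open Classical

/-- `s ⊕ t`: lifted addition on sets of naturals. -/
def setPlus (s t : Set ℕ) : Set ℕ := {u | ∃ m ∈ s, ∃ n ∈ t, u = m + n}

/-- `s ⊗ t`: lifted multiplication on sets of naturals. -/
def setTimes (s t : Set ℕ) : Set ℕ := {u | ∃ m ∈ s, ∃ n ∈ t, u = m * n}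

/-- Sets of naturals definable by (variable-free) arithmetic circuits:
the smallest collection containing `∅`, `ℕ`, all singletons, closed under
union, intersection, complement, `⊕` and `⊗`. -/
inductive ArithDefinable : Set ℕ → Prop
  | empty : ArithDefinable ∅
  | univ : ArithDefinable Set.univ
  | single (k : ℕ) : ArithDefinable {k}
  | union : ∀ {s t : Set ℕ}, ArithDefinable s → ArithDefinable t → ArithDefinable (s ∪ t)
  | inter : ∀ {s t : Set ℕ}, ArithDefinable s → ArithDefinable t → ArithDefinable (s ∩ t)
  | compl : ∀ {s : Set ℕ}, ArithDefinable s → ArithDefinable sᶜ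
  | plus : ∀ {s t : Set ℕ}, ArithDefinable s → ArithDefinable t → ArithDefinable (setPlus s t)
  | times : ∀ {s t : Set ℕ}, ArithDefinable s → ArithDefinable t → ArithDefinable (setTimes s t)

/-- A set-function of arity `k`. -/
abbrev SetFun (k : ℕ) := (Fin k → Set ℕ) → Set ℕ

/-- The `𝒪`-definable functions `ℙ^n → ℙ`, for a collection `O` of set-functions
(given per arity): smallest class containing projections and the constants
`∅`, `ℕ`, `{k}`, closed under pointwise union, intersection, complement, and
composition with functions in `O`. -/
inductive ODef (O : ∀ k, Set (SetFun k)) (n : ℕ) : SetFun n → Prop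
  | proj (i : Fin n) : ODef O n (fun s => s i)
  | empty : ODef O n (fun _ => ∅)
  | univ : ODef O n (fun _ => Set.univ)
  | single (k : ℕ) : ODef O n (fun _ => {k})
  | union : ∀ {F G : SetFun n}, ODef O n F → ODef O n G → ODef O n (fun s => F s ∪ G s)
  | inter : ∀ {F G : SetFun n}, ODef O n F → ODef O n G → ODef O n (fun s => F s ∩ G s)
  | compl : ∀ {F : SetFun n}, ODef O n F → ODef O n (fun s => (F s)ᶜ)
  | comp : ∀ {k : ℕ} {g : SetFun k} {F : Fin k → SetFun n},
      g ∈ O k → (∀ i, ODef O n (F i)) → ODef O n (fun s => g (fun i => F i s))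

/-- `s_{|m} = s ∩ {0,…,m}`. -/
def restrict (s : Set ℕ) (m : ℕ) : Set ℕ := s ∩ {k | k ≤ m}

/-- `F` is `h`-continuous on `D`. -/
def HCont (h : ℕ → ℕ) {n : ℕ} (F : SetFun n) (D : Set (Fin n → Set ℕ)) : Prop :=
  ∀ m : ℕ, ∀ s ∈ D, ∀ t ∈ D,
    (∀ i, restrict (s i) (h m) = restrict (t i) (h m)) →
    restrict (F s) m = restrict (F t) m

/-- `F` is uniformly continuous on `D`. -/
def UnifCont {n : ℕ} (F : SetFun n) (D : Set (Fin n → Set ℕ)) : Prop :=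
  ∃ h : ℕ → ℕ, HCont h F D

/-- `𝒰`: set-functions (of arity `k`) uniformly continuous on the whole space. -/
def Ucal (k : ℕ) : Set (SetFun k) := {g | UnifCont g Set.univ}

/-- `𝒫`: predicates, i.e. set-functions with values among `∅` and `{0}`. -/
def Pcal (k : ℕ) : Set (SetFun k) := {g | ∀ s, g s = ∅ ∨ g s = {0}}

/-- `𝒰 ∪ 𝒫`. -/
def UPcal (k : ℕ) : Set (SetFun k) := Ucal k ∪ Pcal k

/-- `Max(x)`. -/
def MaxFun (x : Set ℕ) : Set ℕ :=
  if x = ∅ then ∅ else if x.Infinite then Set.univ else {sSup x}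

/-- `Card(x)`. -/
def CardFun (x : Set ℕ) : Set ℕ := if x.Finite then {x.ncard} else Set.univ

/-- `↓(x)`. -/
def DownFun (x : Set ℕ) : Set ℕ := {m | ∃ n ∈ x, m ≤ n}

/-- `Sum(x)`. -/
def SumFun (x : Set ℕ) : Set ℕ := if x.Finite then {∑ᶠ n ∈ x, n} else Set.univ

/-- `Prod(x)`. -/
def ProdFun (x : Set ℕ) : Set ℕ := if x.Finite then {∏ᶠ n ∈ x, n} else Set.univ

/-- `Shove(x) = {n - min x : n ∈ x}` (empty for `x = ∅`). -/
def ShoveFun (x : Set ℕ) : Set ℕ := (fun n => n - sInf x) '' x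

/-- `ε(x)`: the test for emptiness. -/
def epsFun (x : Set ℕ) : Set ℕ := if x = ∅ then {0} else ∅

/-- `Fin(x)`: the test for finiteness. -/
def FinFun (x : Set ℕ) : Set ℕ := if x.Finite then {0} else ∅

/-- `⊕` as a set-function of arity 2. -/
def plusFun : SetFun 2 := fun s => setPlus (s 0) (s 1)

/-- `⊗` as a set-function of arity 2. -/
def timesFun : SetFun 2 := fun s => setTimes (s 0) (s 1)

/-- `↓` as a set-function of arity 1. -/
def downFun1 : SetFun 1 := fun s => DownFun (s 0)

/-- `ε` as a set-function of arity 1. -/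
def epsFun1 : SetFun 1 := fun s => epsFun (s 0)

/-- The collection `{⊕, ⊗}`. -/
def arithO : ∀ k, Set (SetFun k)
  | 2 => {plusFun, timesFun}
  | _ => ∅

/-- The collection `{⊕}`. -/
def addO : ∀ k, Set (SetFun k)
  | 2 => {plusFun}
  | _ => ∅

/-- The collection `{⊕, ↓} ∪ 𝒫`. -/
def addDownO : ∀ k, Set (SetFun k)
  | 1 => insert downFun1 (Pcal 1)
  | 2 => insert plusFun (Pcal 2)
  | k => Pcal k

/-- The collection `{⊕, ⊗, ↓} ∪ 𝒫`. -/
def arithDownO : ∀ k, Set (SetFun k)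
  | 1 => insert downFun1 (Pcal 1)
  | 2 => {plusFun, timesFun} ∪ Pcal 2
  | k => Pcal k

/-- The collection `𝒰 ∪ {ε}`. -/
def UEps : ∀ k, Set (SetFun k)
  | 1 => insert epsFun1 (Ucal 1)
  | k => Ucal k

/-- The collection `{⊕, ⊗} ∪ 𝒫`. -/
def arithPO (k : ℕ) : Set (SetFun k) := arithO k ∪ Pcal k

/-- A numerical function `ℕ → ℕ` is `O`-definable if some `O`-definable
set-function maps `{m}` to `{f m}` for every `m`. -/
def NumDef1 (O : ∀ k, Set (SetFun k)) (f : ℕ → ℕ) : Prop :=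
  ∃ F : SetFun 1, ODef O 1 F ∧ ∀ m : ℕ, F (fun _ => {m}) = {f m}

/-- A numerical function `ℕ^k → ℕ` is `O`-definable if some `O`-definable
set-function maps tuples of singletons to the corresponding singleton value. -/
def NumDef (O : ∀ k, Set (SetFun k)) (k : ℕ) (f : (Fin k → ℕ) → ℕ) : Prop :=
  ∃ F : SetFun k, ODef O k F ∧ ∀ m : Fin k → ℕ, F (fun i => ({m i} : Set ℕ)) = {f m}

/-- `f` is regressive: `{f n : f n < n}` is infinite. -/
def Regressive (f : ℕ → ℕ) : Prop := {y | ∃ n, f n = y ∧ y < n}.Infinite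

/-- `f` is semi-regressive: for every `ℓ` there is `n` with `n + ℓ ≤ f n ≤ 2n - 2`. -/
def SemiRegressive (f : ℕ → ℕ) : Prop :=
  ∀ ℓ : ℕ, ∃ n : ℕ, n + ℓ ≤ f n ∧ (f n : ℤ) ≤ 2 * (n : ℤ) - 2

theorem restrict_eq_iff {s t : Set ℕ} {m : ℕ} :
    restrict s m = restrict t m ↔ ∀ k ≤ m, (k ∈ s ↔ k ∈ t) := by
  simp only [restrict, Set.ext_iff, Set.mem_inter_iff, Set.mem_ofPred_eq]
  exact forall_congr' fun k => by tauto

/-- `F` is uniformly continuous on each class of some finite partition of `ℙ^n`,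
with a common modulus. -/
def FinPiecewiseUnifCont {n : ℕ} (F : SetFun n) : Prop :=
  ∃ (κ : Type) (_ : Finite κ) (c : (Fin n → Set ℕ) → κ) (h : ℕ → ℕ),
    ∀ a : κ, HCont h F (c ⁻¹' {a})

theorem HCont.mono_modulus {n : ℕ} {F : SetFun n} {D : Set (Fin n → Set ℕ)} {h h' : ℕ → ℕ}
    (hF : HCont h F D) (hh : ∀ m, h m ≤ h' m) : HCont h' F D := fun m s hs t ht hst =>
  hF m s hs t ht fun i => restrict_eq_iff.2 fun k hk =>
    restrict_eq_iff.1 (hst i) k (hk.trans (hh m))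

theorem HCont.mono_domain {n : ℕ} {F : SetFun n} {D D' : Set (Fin n → Set ℕ)} {h : ℕ → ℕ}
    (hF : HCont h F D) (hD : D' ⊆ D) : HCont h F D' := fun m s hs t ht hst =>
  hF m s (hD hs) t (hD ht) hst

/-- A finite family of piecewise uniformly continuous functions shares a partition and a
modulus. -/
theorem exists_common_partition {n k : ℕ} {F : Fin k → SetFun n}
    (hF : ∀ i, FinPiecewiseUnifCont (F i)) :
    ∃ (κ : Type) (_ : Finite κ) (c : (Fin n → Set ℕ) → κ) (h : ℕ → ℕ),
      ∀ i, ∀ a : κ, HCont h (F i) (c ⁻¹' {a}) := by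
  choose κ hκ c h hc using hF
  refine ⟨∀ i, κ i, inferInstance, fun s i => c i s, fun m => ∑ i, h i m, fun i a => ?_⟩
  refine ((hc i (a i)).mono_domain fun s (hs : _ = a) => show c i s = a i from congrFun hs i).mono_modulus fun m => ?_
  exact Finset.single_le_sum (f := fun i => h i m) (fun _ _ => Nat.zero_le _) (Finset.mem_univ i)

theorem FinPiecewiseUnifCont.comp_unifCont {n k : ℕ} {g : SetFun k} {F : Fin k → SetFun n}
    (hg : UnifCont g Set.univ) (hF : ∀ i, FinPiecewiseUnifCont (F i)) :
    FinPiecewiseUnifCont fun s => g fun i => F i s := by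
  obtain ⟨κ, hκ, c, h, hc⟩ := exists_common_partition hF
  obtain ⟨l, hl⟩ := hg
  exact ⟨κ, hκ, c, h ∘ l, fun a m s hs t ht hst =>
    hl m _ trivial _ trivial fun i => hc i a (l m) s hs t ht hst⟩

theorem FinPiecewiseUnifCont.of_predicate {n : ℕ} {F : SetFun n}
    (hF : ∀ s, F s = ∅ ∨ F s = {0}) : FinPiecewiseUnifCont F := by
  refine ⟨Prop, inferInstance, fun s => F s = ∅, id, fun a m s hs t ht _ => ?_⟩
  have hst : (F s = ∅) = (F t = ∅) := hs.trans ht.symm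
  have : F s = F t := by
    rcases hF s with h | h <;> rcases hF t with h' | h' <;> simp_all
  rw [this]

theorem unifCont_union : UnifCont (n := 2) (fun s => s 0 ∪ s 1) Set.univ :=
  ⟨id, fun _ _ _ _ _ hst => restrict_eq_iff.2 fun k hk => or_congr
    (restrict_eq_iff.1 (hst 0) k hk) (restrict_eq_iff.1 (hst 1) k hk)⟩

theorem unifCont_inter : UnifCont (n := 2) (fun s => s 0 ∩ s 1) Set.univ :=
  ⟨id, fun _ _ _ _ _ hst => restrict_eq_iff.2 fun k hk => and_congr
    (restrict_eq_iff.1 (hst 0) k hk) (restrict_eq_iff.1 (hst 1) k hk)⟩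

theorem unifCont_compl : UnifCont (n := 1) (fun s => (s 0)ᶜ) Set.univ :=
  ⟨id, fun _ _ _ _ _ hst => restrict_eq_iff.2 fun k hk => not_congr
    (restrict_eq_iff.1 (hst 0) k hk)⟩

theorem FinPiecewiseUnifCont.of_unifCont {n : ℕ} {F : SetFun n} (hF : UnifCont F Set.univ) :
    FinPiecewiseUnifCont F := by
  obtain ⟨h, hh⟩ := hF
  exact ⟨Unit, inferInstance, fun _ => (), h, fun _ => hh.mono_domain (Set.subset_univ _)⟩

theorem unifCont_const {n : ℕ} (A : Set ℕ) : UnifCont (n := n) (fun _ => A) Set.univ :=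
  ⟨id, fun _ _ _ _ _ _ => rfl⟩

theorem ODef.finPiecewiseUnifCont {n : ℕ} {F : SetFun n} (hF : ODef UPcal n F) :
    FinPiecewiseUnifCont F := by
  induction hF with
  | proj i => exact .of_unifCont ⟨id, fun _ _ _ _ _ hst => hst i⟩
  | empty => exact .of_unifCont (unifCont_const _)
  | univ => exact .of_unifCont (unifCont_const _)
  | single k => exact .of_unifCont (unifCont_const _)
  | @union F G _ _ hF hG =>
    exact .comp_unifCont (F := ![F, G]) unifCont_union (Fin.forall_fin_two.2 ⟨hF, hG⟩)
  | @inter F G _ _ hF hG =>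
    exact .comp_unifCont (F := ![F, G]) unifCont_inter (Fin.forall_fin_two.2 ⟨hF, hG⟩)
  | @compl F _ hF =>
    exact .comp_unifCont (F := fun _ : Fin 1 => F) unifCont_compl fun _ => hF
  | comp hg _ hF =>
    rcases hg with hg | hg
    · exact .comp_unifCont hg hF
    · exact .of_predicate fun s => hg _

/-- A function sending finite sets `A` of positive numbers to singletons `{φ A}`, where `φ`
grows strictly under insertion of a large new element, is not `(𝒰 ∪ 𝒫)`-definable. -/
theorem not_oDef_of_strict_growth {F : Set ℕ → Set ℕ} {φ : Finset ℕ → ℕ}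
    (hFφ : ∀ A : Finset ℕ, F ↑A = {φ A})
    (hφ : ∀ A : Finset ℕ, 0 ∉ A → ∀ n ∉ A, 2 ≤ n → φ A < φ (insert n A)) :
    ¬ ODef UPcal 1 (fun v => F (v 0)) := by
  intro hdef
  obtain ⟨κ, hκ, c, h₀, hc₀⟩ := hdef.finPiecewiseUnifCont
  let h : ℕ → ℕ := fun m => ∑ l ∈ Finset.range (m + 1), h₀ l
  have hmono : Monotone h := fun a b hab =>
    Finset.sum_le_sum_of_subset (Finset.range_mono (by lia))
  have hc (a : κ) : HCont h (fun v => F (v 0)) (c ⁻¹' {a}) := (hc₀ a).mono_modulus fun m =>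
    Finset.single_le_sum (f := h₀) (fun _ _ => Nat.zero_le _) (Finset.self_mem_range_succ m)
  let e : Finset ℕ → ℕ := fun A => h (φ A) + A.sup id + 2
  have he (A : Finset ℕ) : e A ∉ A := fun hA => by
    have : e A ≤ A.sup id := Finset.le_sup (f := id) hA
    simp only [e] at this
    lia
  let S : ℕ → Finset ℕ := fun i => Nat.rec ∅ (fun _ A => insert (e A) A) i
  have hS (i : ℕ) : S (i + 1) = insert (e (S i)) (S i) := rfl
  have hS0 (i : ℕ) : 0 ∉ S i := by
    induction i with
    | zero => simp [S]
    | succ i ih => simp [hS, ih, e]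
  have hlt : StrictMono (φ ∘ S) := strictMono_nat_of_lt_succ fun i => by
    simpa [hS] using hφ (S i) (hS0 i) _ (he _) (by simp [e])
  have hagree (i j : ℕ) (hij : i ≤ j) : ∀ k ≤ h (φ (S i)), k ∈ S i ↔ k ∈ S j := by
    induction j, hij using Nat.le_induction with
    | base => simp
    | succ j hij ih =>
      intro k hk
      have hle : h (φ (S i)) ≤ h (φ (S j)) := hmono (hlt.monotone hij)
      have hne : k ≠ e (S j) := by simp only [e]; lia
      rw [hS, Finset.mem_insert, ih k hk]
      simp [hne]
  let T : ℕ → Fin 1 → Set ℕ := fun i _ => SetLike.coe (S i)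
  have hcol (i j : ℕ) (hij : i < j) : c (T i) ≠ c (T j) := by
    intro hcij
    have key := hc _ (φ (S i)) (T i) hcij (T j) rfl
      fun _ => restrict_eq_iff.2 (by simpa [T] using hagree i j hij.le)
    have := restrict_eq_iff.1 key (φ (S i)) le_rfl
    simp only [T, hFφ, Set.mem_singleton_iff, true_iff] at this
    exact (hlt hij).ne this
  obtain ⟨i, j, hij, heq⟩ := Finite.exists_ne_map_eq_of_infinite (c ∘ T)
  rcases hij.lt_or_gt with hij | hij
  · exact hcol i j hij heq
  · exact hcol j i hij heq.symm

theorem SumFun_coe (A : Finset ℕ) : SumFun ↑A = {∑ n ∈ A, n} := by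
  rw [SumFun, if_pos A.finite_toSet, finsum_mem_coe_finset]

theorem ProdFun_coe (A : Finset ℕ) : ProdFun ↑A = {∏ n ∈ A, n} := by
  rw [ProdFun, if_pos A.finite_toSet, finprod_mem_coe_finset]

theorem sum_prod_not_UP_definable :
    ¬ ODef UPcal 1 (fun v => SumFun (v 0)) ∧
    ¬ ODef UPcal 1 (fun v => ProdFun (v 0)) := by
  refine ⟨not_oDef_of_strict_growth SumFun_coe fun A _ n hn h2 => ?_,
    not_oDef_of_strict_growth ProdFun_coe fun A hA n hn h2 => ?_⟩
  · rw [Finset.sum_insert hn]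
    lia
  · rw [Finset.prod_insert hn]
    have hpos : 0 < ∏ k ∈ A, k :=
      Finset.prod_pos fun k hk => Nat.pos_of_ne_zero fun h => hA (h ▸ hk)
    nlinarith

end
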